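/- arXiv:0809.2065 — 2 statements merged into one kernel-verified Lean document; each statement's English description precedes it below -/
import Mathlib

section
/- Let C be the middle-third Cantor set in ℝ. Then the winning dimension of C ∩ BA(1,1) for Schmidt's game played on C is at most 1/3; that is, for every α > 1/3 there exists β ∈ (0,1) such that C ∩ BA(1,1) is not (α,β)-winning for Schmidt's game played on C. -/
open Metric

noncomputable section

/-- Badly approximable real numbers: ⟨qx⟩ > C/q for all positive integers q. -/
def BAone : Set ℝ :=
  {x | ∃ C : ℝ, 0 < C ∧ ∀ q : ℕ, 0 < q →
    |(q : ℝ) * x - (round ((q : ℝ) * x) : ℤ)| > C / (q : ℝ)}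

section Game

variable {E : Type*} [MetricSpace E]

/-- Legality of Black's k-th move in the (α,β)-Schmidt game on K with initial radius ρ. -/
def BlackLegal (K : Set E) (α β ρ : ℝ) (b w : ℕ → E) : ℕ → Prop
  | 0 => b 0 ∈ K
  | k + 1 => b (k + 1) ∈ K ∧
      closedBall (b (k + 1)) ((α * β) ^ (k + 1) * ρ) ⊆
        closedBall (w k) (α * ((α * β) ^ k * ρ))

/-- Legality of White's k-th move. -/
def WhiteLegal (K : Set E) (α β ρ : ℝ) (b w : ℕ → E) (k : ℕ) : Prop :=
  w k ∈ K ∧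
    closedBall (w k) (α * ((α * β) ^ k * ρ)) ⊆ closedBall (b k) ((α * β) ^ k * ρ)

/-- White has a strategy, in the (α,β)-game on K starting from Black's ball B(x₀,ρ),
which always produces legal moves and forces property P of Black's sequence of centers. -/
def WhiteCanForce (K : Set E) (α β : ℝ) (x₀ : E) (ρ : ℝ) (P : (ℕ → E) → Prop) : Prop :=
  ∃ f : List E → E, ∀ b : ℕ → E, b 0 = x₀ →
    ∀ w : ℕ → E, (∀ k, w k = f (List.ofFn fun i : Fin (k + 1) => b (i : ℕ))) →
      (∀ k, (∀ j, j ≤ k → BlackLegal K α β ρ b w j) → WhiteLegal K α β ρ b w k) ∧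
      ((∀ k, BlackLegal K α β ρ b w k) → P b)

/-- The target set S is (α,β)-winning for the Schmidt game played on K. -/
def ABWinning (K S : Set E) (α β : ℝ) : Prop :=
  ∀ x₀ ∈ K, ∀ ρ : ℝ, 0 < ρ → ρ ≤ diam K →
    WhiteCanForce K α β x₀ ρ (fun b =>
      ∀ z : E, (∀ k, z ∈ closedBall (b k) ((α * β) ^ k * ρ)) → z ∈ S)

end Game

/-- A point of the Cantor set to the left of the interval `[2 / 3 ^ (m + 1), 3 / 3 ^ (m + 1)]`
is at most `1 / 3 ^ (m + 1)`. -/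
theorem le_of_mem_cantorSet_of_lt (m : ℕ) {x : ℝ} (hx : x ∈ cantorSet)
    (hlt : x < 2 / 3 ^ (m + 1)) : x ≤ 1 / 3 ^ (m + 1) := by
  induction m generalizing x with
  | zero =>
    rw [cantorSet_eq_union_halves] at hx
    rcases hx with ⟨y, hy, rfl⟩ | ⟨y, hy, rfl⟩ <;> have h := cantorSet_subset_unitInterval hy
    · have := h.2
      norm_num
      linarith
    · have := h.1
      norm_num at hlt
      linarith
  | succ m ih =>
    have hp : (1 : ℝ) ≤ 3 ^ (m + 1) := one_le_pow₀ (by norm_num)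
    have hq : (2 : ℝ) / 3 ^ (m + 1) ≤ 2 := div_le_self (by norm_num) hp
    have h2 : (2 : ℝ) / 3 ^ (m + 1 + 1) = 2 / 3 ^ (m + 1) / 3 := by rw [pow_succ _ (m + 1)]; ring
    have h1 : (1 : ℝ) / 3 ^ (m + 1 + 1) = 1 / 3 ^ (m + 1) / 3 := by rw [pow_succ _ (m + 1)]; ring
    rw [h2] at hlt
    rw [h1]
    rw [cantorSet_eq_union_halves] at hx
    rcases hx with ⟨y, hy, rfl⟩ | ⟨y, hy, rfl⟩ <;> have h := cantorSet_subset_unitInterval hy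
    · have := ih hy (by dsimp only at hlt; linarith)
      dsimp only
      linarith
    · have := h.1
      dsimp only at hlt
      linarith

theorem one_mem_cantorSet : (1 : ℝ) ∈ cantorSet := by
  simp only [cantorSet, Set.mem_iInter]
  intro n
  induction n with
  | zero => simp
  | succ n ih => exact Or.inr ⟨1, ih, by norm_num⟩

theorem one_le_diam_cantorSet : 1 ≤ diam cantorSet := by
  simpa using dist_le_diam_of_mem isCompact_cantorSet.isBounded one_mem_cantorSet
    zero_mem_cantorSet

theorem zero_notMem_BAone : (0 : ℝ) ∉ BAone := by
  rintro ⟨C, hC, h⟩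
  have := h 1 one_pos
  norm_num at this
  linarith

/-- **Proposition 5.1 of Fishman.** The winning dimension of C ∩ BA(1,1) for Schmidt's game
played on the middle-third Cantor set C is at most 1/3: for every α > 1/3 there is β ∈ (0,1)
such that C ∩ BA(1,1) is not (α,β)-winning on C. -/
theorem windim_cantor_le_third :
    ∀ α : ℝ, 1 / 3 < α → α < 1 →
      ∃ β : ℝ, 0 < β ∧ β < 1 ∧ ¬ ABWinning cantorSet (cantorSet ∩ BAone) α β := by
  intro α hα hα1
  obtain ⟨n, hn⟩ := exists_pow_lt_of_lt_one (sub_pos.mpr hα) (by norm_num : (1 / 3 : ℝ) < 1)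
  have hα0 : 0 < α := by linarith
  refine ⟨(1 / 3) ^ n / α, by positivity, (div_lt_one hα0).mpr (by linarith), fun hwin => ?_⟩
  have hab : α * ((1 / 3) ^ n / α) = (1 / 3 : ℝ) ^ n := by field_simp
  obtain ⟨f, hf⟩ := hwin 0 zero_mem_cantorSet 1 one_pos one_le_diam_cantorSet
  obtain ⟨hwhite, htarget⟩ := hf (fun _ => 0) rfl _ fun _ => rfl
  refine zero_notMem_BAone (htarget (fun k => ?_) 0 fun k => ?_).2
  · induction k using Nat.strong_induction_on with
    | _ k ih =>
      cases k with
      | zero => exact zero_mem_cantorSet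
      | succ k =>
        obtain ⟨hwmem, hwball⟩ := hwhite k fun j hj => ih j (Nat.lt_succ_of_le hj)
        refine ⟨zero_mem_cantorSet, ?_⟩
        set w := f (List.ofFn fun _ : Fin (k + 1) => (0 : ℝ))
        rw [hab, mul_one] at hwball ⊢
        set r : ℝ := ((1 / 3) ^ n) ^ k with hr
        have hr0 : 0 < r := by positivity
        have hw0 : 0 ≤ w := (cantorSet_subset_unitInterval hwmem).1
        have hwle : w + α * r ≤ r := by
          have hmem : w + α * r ∈ closedBall (0 : ℝ) r := hwball (by
            change dist (w + α * r) w ≤ α * r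
            rw [Real.dist_eq, add_sub_cancel_left, abs_of_pos (mul_pos hα0 hr0)])
          rw [mem_closedBall, Real.dist_eq, sub_zero] at hmem
          exact (le_abs_self _).trans hmem
        have hr3 : r = 3 * (1 / 3 ^ (n * k + 1)) := by
          rw [hr, ← pow_mul, one_div, inv_pow, pow_succ]
          field_simp
        have hw3 : w ≤ r / 3 := by
          have := le_of_mem_cantorSet_of_lt (n * k) hwmem (by
            rw [show (2 : ℝ) / 3 ^ (n * k + 1) = 2 * (1 / 3 ^ (n * k + 1)) by ring]
            nlinarith)
          linarith
        refine closedBall_subset_closedBall' ?_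
        rw [Real.dist_eq, zero_sub, abs_neg, abs_of_nonneg hw0, mul_one, pow_succ, ← hr]
        nlinarith
  · have : 0 ≤ α * ((1 / 3) ^ n / α) := by rw [hab]; positivity
    exact mem_closedBall_self (by positivity)
end
end

section
/- There exists a finite Borel measure τ on ℝ which is absolutely friendly, whose support is a compact subset of [0,1] (namely the set of real numbers whose continued fraction expansion has all partial quotients in {1,3}), and which satisfies τ(BA(1,1) ∩ supp τ) = τ(ℝ) = 1; in particular, it is not true in general that an absolutely friendly measure gives measure zero to the badly approximable numbers in its support. -/
open Metric MeasureTheory Filter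

noncomputable section

/-- The support of a measure: points all of whose neighborhoods have positive measure. -/
def msupport (τ : Measure ℝ) : Set ℝ :=
  {x | ∀ r : ℝ, 0 < r → 0 < τ (ball x r)}

/-- Absolutely friendly measure on ℝ (an affine hyperplane of ℝ is a point, and its
ε-neighborhood is an open ball). -/
def AbsolutelyFriendly1 (τ : Measure ℝ) : Prop :=
  ∃ ρmax C D a : ℝ, 0 < ρmax ∧ 0 < C ∧ 0 < D ∧ 0 < a ∧
    ∀ ρ : ℝ, 0 < ρ → ρ ≤ ρmax → ∀ x ∈ msupport τ,
      (∀ ε : ℝ, 0 < ε → ε ≤ ρ → ∀ p : ℝ,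
        τ (closedBall x ρ ∩ ball p ε) <
          ENNReal.ofReal (C * (ε / ρ) ^ a) * τ (closedBall x ρ)) ∧
      ENNReal.ofReal D * τ (closedBall x ρ) < τ (closedBall x (ρ / 2))

/-- The set of real numbers in (0,1) whose continued fraction expansion
[0; a₁, a₂, …] has all partial quotients aᵢ ∈ {1,3}; x is the limit of the convergents
pₙ/qₙ given by the standard recursions. -/
def cfSet13 : Set ℝ :=
  {x | ∃ a : ℕ → ℕ, (∀ n, a n = 1 ∨ a n = 3) ∧
    ∃ p q : ℕ → ℝ, p 0 = 0 ∧ p 1 = 1 ∧ q 0 = 1 ∧ q 1 = (a 0 : ℝ) ∧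
      (∀ n, p (n + 2) = (a (n + 1) : ℝ) * p (n + 1) + p n) ∧
      (∀ n, q (n + 2) = (a (n + 1) : ℝ) * q (n + 1) + q n) ∧
      Tendsto (fun n => p n / q n) atTop (nhds x)}

namespace ContinuedFraction13

/-- The partial quotient encoded by a Boolean: `3` for `true`, `1` for `false`. -/
def digit (b : Bool) : ℕ := if b then 3 else 1

/-- Numerators of the convergents of the continued fraction with partial quotients
`digit (ω i)`. -/
def num (ω : ℕ → Bool) : ℕ → ℝ
  | 0 => 0
  | 1 => 1
  | n + 2 => digit (ω (n + 1)) * num ω (n + 1) + num ω n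

/-- Denominators of the convergents of the continued fraction with partial quotients
`digit (ω i)`. -/
def den (ω : ℕ → Bool) : ℕ → ℝ
  | 0 => 1
  | 1 => digit (ω 0)
  | n + 2 => digit (ω (n + 1)) * den ω (n + 1) + den ω n

/-- The value of the continued fraction with partial quotients `digit (ω i)`. -/
def value (ω : ℕ → Bool) : ℝ := limUnder atTop fun n => num ω n / den ω n

/-- The scale of the `n`-th cylinder around `ω`. -/
def scale (ω : ℕ → Bool) (n : ℕ) : ℝ := 1 / den ω n ^ 2

/-- The sequence `ω` with its first `n` terms removed. -/
def drop (ω : ℕ → Bool) (n : ℕ) : ℕ → Bool := fun i => ω (n + i)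

/-- The sequences which agree with `ω` at the first `n` places. -/
def cyl (ω : ℕ → Bool) (n : ℕ) : Set (ℕ → Bool) := {ω' | ∀ i < n, ω i = ω' i}

lemma one_le_digit (b : Bool) : (1 : ℝ) ≤ digit b := by cases b <;> norm_num [digit]

lemma digit_le_three (b : Bool) : (digit b : ℝ) ≤ 3 := by cases b <;> norm_num [digit]

lemma one_le_den_and_monotone (ω : ℕ → Bool) (n : ℕ) :
    1 ≤ den ω n ∧ den ω n ≤ den ω (n + 1) := by
  induction n with
  | zero => simpa [den] using one_le_digit (ω 0)
  | succ n ih =>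
    have h := one_le_digit (ω (n + 1))
    refine ⟨by linarith, ?_⟩
    simp only [den]
    nlinarith

lemma one_le_den (ω : ℕ → Bool) (n : ℕ) : 1 ≤ den ω n := (one_le_den_and_monotone ω n).1

lemma den_pos (ω : ℕ → Bool) (n : ℕ) : 0 < den ω n := by linarith [one_le_den ω n]

lemma den_le_succ (ω : ℕ → Bool) (n : ℕ) : den ω n ≤ den ω (n + 1) :=
  (one_le_den_and_monotone ω n).2

lemma den_succ_le (ω : ℕ → Bool) (n : ℕ) : den ω (n + 1) ≤ 4 * den ω n := by
  cases n with
  | zero => have := digit_le_three (ω 0); simp only [den]; linarith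
  | succ n =>
    have := digit_le_three (ω (n + 1))
    have h := den_le_succ ω n
    have h1 := den_pos ω (n + 1)
    simp only [den]
    nlinarith

lemma two_mul_den_le (ω : ℕ → Bool) (n : ℕ) : 2 * den ω n ≤ den ω (n + 2) := by
  have := one_le_digit (ω (n + 1))
  have h := den_le_succ ω n
  have h1 := den_pos ω (n + 1)
  simp only [den]
  nlinarith

lemma two_pow_le_den_mul_den (ω : ℕ → Bool) (n : ℕ) : 2 ^ n ≤ den ω n * den ω (n + 1) := by
  induction n with
  | zero => simpa [den] using one_le_digit (ω 0)
  | succ n ih =>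
    have h := two_mul_den_le ω n
    have h1 := den_pos ω (n + 1)
    rw [pow_succ]
    nlinarith

lemma two_pow_le_den (ω : ℕ → Bool) (n : ℕ) : 2 ^ n ≤ den ω (2 * n) := by
  induction n with
  | zero => simp [den]
  | succ n ih =>
    have h := two_mul_den_le ω (2 * n)
    rw [pow_succ, show 2 * (n + 1) = 2 * n + 2 by ring]
    linarith

lemma num_mul_den_sub (ω : ℕ → Bool) (n : ℕ) :
    num ω (n + 1) * den ω n - num ω n * den ω (n + 1) = (-1) ^ n := by
  induction n with
  | zero => simp [num, den]
  | succ n ih => simp only [num, den] at ih ⊢; rw [pow_succ]; linarith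

lemma num_nonneg_and_le (ω : ℕ → Bool) (n : ℕ) :
    (0 ≤ num ω n ∧ num ω n ≤ den ω n) ∧ (0 ≤ num ω (n + 1) ∧ num ω (n + 1) ≤ den ω (n + 1)) := by
  induction n with
  | zero => simpa [num, den] using one_le_digit (ω 0)
  | succ n ih =>
    obtain ⟨⟨h1, h2⟩, h3, h4⟩ := ih
    have h := one_le_digit (ω (n + 1))
    refine ⟨⟨h3, h4⟩, ?_, ?_⟩
    · simp only [num]; positivity
    · simp only [num, den]; gcongr

lemma exists_int_eq_num_den (ω : ℕ → Bool) (n : ℕ) :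
    ((∃ z : ℤ, num ω n = z) ∧ ∃ z : ℤ, den ω n = z) ∧
      (∃ z : ℤ, num ω (n + 1) = z) ∧ ∃ z : ℤ, den ω (n + 1) = z := by
  induction n with
  | zero =>
    exact ⟨⟨⟨0, by simp [num]⟩, 1, by simp [den]⟩, ⟨1, by simp [num]⟩, digit (ω 0), by simp [den]⟩
  | succ n ih =>
    obtain ⟨⟨⟨a, ha⟩, b, hb⟩, ⟨c, hc⟩, d, hd⟩ := ih
    exact ⟨⟨⟨c, hc⟩, d, hd⟩, ⟨digit (ω (n + 1)) * c + a, by simp [num, ha, hc]⟩,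
      digit (ω (n + 1)) * d + b, by simp [den, hb, hd]⟩

lemma tendsto_value (ω : ℕ → Bool) :
    Tendsto (fun n => num ω n / den ω n) atTop (nhds (value ω)) := by
  apply CauchySeq.tendsto_limUnder
  refine cauchySeq_of_le_geometric (1 / 2) 1 (by norm_num) fun n => ?_
  have h0 := den_pos ω n
  have h1 := den_pos ω (n + 1)
  rw [dist_comm, Real.dist_eq, div_sub_div _ _ h1.ne' h0.ne', mul_comm (den ω (n + 1)),
    num_mul_den_sub, abs_div, abs_pow, abs_neg, abs_one, one_pow,
    abs_of_pos (mul_pos h1 h0), one_mul, one_div_pow, mul_comm]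
  exact one_div_le_one_div_of_le (by positivity) (two_pow_le_den_mul_den ω n)

lemma value_nonneg (ω : ℕ → Bool) : 0 ≤ value ω :=
  ge_of_tendsto' (tendsto_value ω) fun n =>
    div_nonneg (num_nonneg_and_le ω n).1.1 (den_pos ω n).le

lemma value_le_one (ω : ℕ → Bool) : value ω ≤ 1 :=
  le_of_tendsto' (tendsto_value ω) fun n =>
    div_le_one_of_le₀ (num_nonneg_and_le ω n).1.2 (den_pos ω n).le

lemma num_den_succ (ω : ℕ → Bool) (n : ℕ) :
    (num ω (n + 1) = den (drop ω 1) n ∧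
      den ω (n + 1) = digit (ω 0) * den (drop ω 1) n + num (drop ω 1) n) ∧
    (num ω (n + 2) = den (drop ω 1) (n + 1) ∧
      den ω (n + 2) = digit (ω 0) * den (drop ω 1) (n + 1) + num (drop ω 1) (n + 1)) := by
  induction n with
  | zero => simp [num, den, drop, mul_comm]
  | succ n ih =>
    obtain ⟨⟨h1, h2⟩, h3, h4⟩ := ih
    refine ⟨⟨h3, h4⟩, ?_, ?_⟩
    · rw [num, h3, h1, den, drop, show 1 + (n + 1) = n + 1 + 1 by ring]
    · rw [den, h4, h2, den, num, drop, show 1 + (n + 1) = n + 1 + 1 by ring]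
      ring

lemma value_eq_drop_one (ω : ℕ → Bool) :
    value ω = 1 / (digit (ω 0) + value (drop ω 1)) := by
  have hpos : (digit (ω 0) : ℝ) + value (drop ω 1) ≠ 0 := by
    linarith [one_le_digit (ω 0), value_nonneg (drop ω 1)]
  refine tendsto_nhds_unique ((tendsto_value ω).comp (tendsto_add_atTop_nat 1)) ?_
  have := ((tendsto_value (drop ω 1)).const_add (digit (ω 0) : ℝ)).inv₀ hpos
  rw [one_div]
  refine this.congr fun n => ?_
  have h := den_pos (drop ω 1) n
  simp only [Function.comp, (num_den_succ ω n).1.1, (num_den_succ ω n).1.2]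
  rw [add_div' _ _ _ h.ne', inv_div]

lemma value_drop (ω : ℕ → Bool) (n : ℕ) :
    value (drop ω n) = 1 / (digit (ω n) + value (drop ω (n + 1))) := by
  have h : drop (drop ω n) 1 = drop ω (n + 1) := by ext i; simp only [drop, add_assoc]
  have h0 : drop ω n 0 = ω n := rfl
  rw [value_eq_drop_one, h, h0]

lemma value_mul_eq (ω : ℕ → Bool) (n : ℕ) :
    value ω * (den ω (n + 1) + den ω n * value (drop ω (n + 1))) =
      num ω (n + 1) + num ω n * value (drop ω (n + 1)) := by
  induction n with
  | zero =>
    have h := value_eq_drop_one ω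
    have hpos : (digit (ω 0) : ℝ) + value (drop ω 1) ≠ 0 := by
      linarith [one_le_digit (ω 0), value_nonneg (drop ω 1)]
    rw [eq_div_iff hpos] at h
    simpa [num, den] using h
  | succ n ih =>
    have h := value_drop ω (n + 1)
    have hpos : (digit (ω (n + 1)) : ℝ) + value (drop ω (n + 2)) ≠ 0 := by
      linarith [one_le_digit (ω (n + 1)), value_nonneg (drop ω (n + 2))]
    rw [h] at ih
    field_simp at ih
    simp only [num, den]
    linarith

lemma scale_pos (ω : ℕ → Bool) (n : ℕ) : 0 < scale ω n := by
  have := den_pos ω n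
  unfold scale; positivity

lemma scale_zero (ω : ℕ → Bool) : scale ω 0 = 1 := by simp [scale, den]

lemma scale_succ_le (ω : ℕ → Bool) (n : ℕ) : scale ω (n + 1) ≤ scale ω n := by
  have h := den_pos ω n
  unfold scale
  gcongr
  exact den_le_succ ω n

lemma scale_le_succ (ω : ℕ → Bool) (n : ℕ) : scale ω n / 16 ≤ scale ω (n + 1) := by
  have h := den_pos ω n
  have h1 := den_pos ω (n + 1)
  have h2 := den_succ_le ω n
  unfold scale
  rw [div_div]
  gcongr
  nlinarith

lemma scale_mul_pow_le (ω : ℕ → Bool) (n j : ℕ) :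
    scale ω n * (1 / 16) ^ j ≤ scale ω (n + j) := by
  induction j with
  | zero => simp
  | succ j ih =>
    have := scale_le_succ ω (n + j)
    rw [pow_succ, ← add_assoc]
    linarith

lemma scale_add_two_le (ω : ℕ → Bool) (n : ℕ) : scale ω (n + 2) ≤ scale ω n / 4 := by
  have h := den_pos ω n
  have h2 := two_mul_den_le ω n
  unfold scale
  rw [div_div]
  gcongr
  nlinarith

lemma exists_scale_lt (ω : ℕ → Bool) {ρ : ℝ} (hρ : 0 < ρ) : ∃ n, scale ω n < ρ := by
  obtain ⟨n, hn⟩ := exists_pow_lt_of_lt_one hρ (show (1 / 2 : ℝ) < 1 by norm_num)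
  refine ⟨2 * n, lt_of_le_of_lt ?_ hn⟩
  have h := two_pow_le_den ω n
  have h1 := one_le_den ω (2 * n)
  unfold scale
  rw [one_div_pow]
  gcongr
  nlinarith

lemma num_den_congr {ω ω' : ℕ → Bool} (n : ℕ) (h : ∀ i < n + 1, ω i = ω' i) :
    (num ω n = num ω' n ∧ den ω n = den ω' n) ∧
      num ω (n + 1) = num ω' (n + 1) ∧ den ω (n + 1) = den ω' (n + 1) := by
  induction n with
  | zero => simp [num, den, h 0]
  | succ n ih =>
    obtain ⟨⟨h1, h2⟩, h3, h4⟩ := ih fun i hi => h i (by omega)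
    refine ⟨⟨h3, h4⟩, ?_, ?_⟩
    · rw [num, num, h1, h3, h (n + 1) (by omega)]
    · rw [den, den, h2, h4, h (n + 1) (by omega)]

lemma value_sub_bounds {ω ω' : ℕ → Bool} (n : ℕ) (h : ω' ∈ cyl ω n) :
    scale ω n / 4 * |value (drop ω n) - value (drop ω' n)| ≤ |value ω - value ω'| ∧
      |value ω - value ω'| ≤ scale ω n * |value (drop ω n) - value (drop ω' n)| := by
  cases n with
  | zero =>
    have h0 : ∀ η : ℕ → Bool, drop η 0 = η := fun η => by ext i; simp [drop]
    rw [scale_zero, h0, h0]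
    constructor <;> linarith [abs_nonneg (value ω - value ω')]
  | succ n =>
    obtain ⟨⟨h1, h2⟩, h3, h4⟩ := num_den_congr n h
    have e := value_mul_eq ω n
    have e' := value_mul_eq ω' n
    rw [← h1, ← h2, ← h3, ← h4] at e'
    set S := value (drop ω (n + 1))
    set T := value (drop ω' (n + 1))
    have hS := value_nonneg (drop ω (n + 1))
    have hT := value_nonneg (drop ω' (n + 1))
    have hS' := value_le_one (drop ω (n + 1))
    have hT' := value_le_one (drop ω' (n + 1))
    have hq := den_pos ω n
    have hq' := den_pos ω (n + 1)
    have hqq := den_le_succ ω n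
    have hd := num_mul_den_sub ω n
    set u := den ω (n + 1) + den ω n * S with hu
    set v := den ω (n + 1) + den ω n * T with hv
    have hu1 : den ω (n + 1) ≤ u := by rw [hu]; nlinarith
    have hv1 : den ω (n + 1) ≤ v := by rw [hv]; nlinarith
    have hu2 : u ≤ 2 * den ω (n + 1) := by rw [hu]; nlinarith
    have hv2 : v ≤ 2 * den ω (n + 1) := by rw [hv]; nlinarith
    have hu0 : 0 < u := by linarith
    have hv0 : 0 < v := by linarith
    have key : (value ω - value ω') * (u * v) = -(-1) ^ n * (S - T) := by
      have : (value ω - value ω') * (u * v) = (value ω * u) * v - (value ω' * v) * u := by ring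
      rw [this, e, e', hu, hv, ← hd]
      ring
    have key' : |value ω - value ω'| * (u * v) = |S - T| := by
      have := congrArg abs key
      simpa [abs_mul, abs_of_pos hu0, abs_of_pos hv0] using this
    rw [← key']
    have huv1 : den ω (n + 1) ^ 2 ≤ u * v := by rw [sq]; gcongr
    have huv2 : u * v ≤ 4 * den ω (n + 1) ^ 2 := by nlinarith
    have hA := abs_nonneg (value ω - value ω')
    unfold scale
    constructor
    · rw [div_div, one_div_mul_eq_div, div_le_iff₀ (by positivity)]
      exact mul_le_mul_of_nonneg_left (by linarith) hA
    · rw [one_div_mul_eq_div, le_div_iff₀ (by positivity)]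
      gcongr

lemma abs_value_sub_le {ω ω' : ℕ → Bool} {n : ℕ} (h : ω' ∈ cyl ω n) :
    |value ω - value ω'| ≤ scale ω n := by
  refine (value_sub_bounds n h).2.trans (mul_le_of_le_one_right (scale_pos ω n).le ?_)
  have := value_nonneg (drop ω n)
  have := value_nonneg (drop ω' n)
  have := value_le_one (drop ω n)
  have := value_le_one (drop ω' n)
  rw [abs_le]
  constructor <;> linarith

lemma le_abs_value_sub_of_head_ne {ω ω' : ℕ → Bool} (h : ω 0 ≠ ω' 0) :
    1 / 6 ≤ |value ω - value ω'| := by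
  wlog hω : ω 0 = false generalizing ω ω'
  · rw [abs_sub_comm]
    refine this h.symm ?_
    cases h0 : ω 0 <;> cases h1 : ω' 0 <;> simp_all
  have hω' : ω' 0 = true := by cases h1 : ω' 0 <;> simp_all
  have e := value_eq_drop_one ω
  have e' := value_eq_drop_one ω'
  have h1 := value_nonneg (drop ω' 1)
  have h2 := value_nonneg (drop ω 1)
  have h3 := value_le_one (drop ω 1)
  rw [hω] at e
  rw [hω'] at e'
  simp only [digit] at e e'
  norm_num at e e'
  have a1 : 1 / 2 ≤ value ω := by
    rw [e, ← one_div]; apply one_div_le_one_div_of_le <;> linarith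
  have a2 : value ω' ≤ 1 / 3 := by
    rw [e', ← one_div]; apply one_div_le_one_div_of_le <;> linarith
  refine le_trans ?_ (le_abs_self _)
  linarith

lemma le_abs_value_sub {ω ω' : ℕ → Bool} {n : ℕ} (h : ω' ∈ cyl ω n) (hn : ω n ≠ ω' n) :
    scale ω n / 24 ≤ |value ω - value ω'| := by
  have h1 := le_abs_value_sub_of_head_ne (ω := drop ω n) (ω' := drop ω' n) (by simpa [drop] using hn)
  have h2 := (value_sub_bounds n h).1
  have h3 := scale_pos ω n
  nlinarith

lemma mem_cyl_of_abs_lt {ω ω' : ℕ → Bool} {n : ℕ} (h : |value ω - value ω'| < scale ω n / 24) :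
    ω' ∈ cyl ω n := by
  induction n with
  | zero => simp [cyl]
  | succ n ih =>
    have h1 := scale_succ_le ω n
    have h2 := ih (by linarith)
    intro i hi
    rcases Nat.lt_succ_iff_lt_or_eq.1 hi with hi | rfl
    · exact h2 i hi
    · by_contra hne
      linarith [le_abs_value_sub h2 hne]

lemma cyl_eq_pi (ω : ℕ → Bool) (n : ℕ) :
    cyl ω n = Set.pi (Finset.range n : Set ℕ) fun i => {ω i} := by
  ext ω'
  simp [cyl, Set.mem_pi, eq_comm]

lemma isOpen_cyl (ω : ℕ → Bool) (n : ℕ) : IsOpen (cyl ω n) := by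
  rw [cyl_eq_pi]
  exact isOpen_set_pi (Finset.finite_toSet _) fun i _ => isOpen_discrete _

lemma continuous_value : Continuous value := by
  rw [continuous_iff_continuousAt]
  intro ω
  rw [ContinuousAt, Metric.tendsto_nhds]
  intro ε hε
  obtain ⟨n, hn⟩ := exists_scale_lt ω hε
  filter_upwards [(isOpen_cyl ω n).mem_nhds (show ω ∈ cyl ω n from fun i _ => rfl)] with ω' h
  rw [dist_comm, Real.dist_eq]
  exact (abs_value_sub_le h).trans_lt hn

lemma range_value : Set.range value = cfSet13 := by
  ext x
  constructor
  · rintro ⟨ω, rfl⟩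
    refine ⟨fun n => digit (ω n), fun n => ?_, num ω, den ω, rfl, rfl, rfl, rfl,
      fun n => rfl, fun n => rfl, tendsto_value ω⟩
    cases ω n <;> simp [digit]
  · rintro ⟨a, ha, p, q, hp0, hp1, hq0, hq1, hp, hq, hx⟩
    refine ⟨fun n => decide (a n = 3), tendsto_nhds_unique (tendsto_value _) ?_⟩
    set ω : ℕ → Bool := fun n => decide (a n = 3) with hω
    have hd : ∀ n, digit (ω n) = a n := fun n => by
      rcases ha n with h | h <;> simp [digit, hω, h]
    have key : ∀ n, (p n = num ω n ∧ q n = den ω n) ∧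
        p (n + 1) = num ω (n + 1) ∧ q (n + 1) = den ω (n + 1) := fun n => by
      induction n with
      | zero => simp [num, den, hp0, hp1, hq0, hq1, hd]
      | succ n ih =>
        obtain ⟨⟨h1, h2⟩, h3, h4⟩ := ih
        exact ⟨⟨h3, h4⟩, by rw [hp, num, h1, h3, hd], by rw [hq, den, h2, h4, hd]⟩
    exact hx.congr fun n => by rw [(key n).1.1, (key n).1.2]

lemma abs_value_sub_convergent_le (ω : ℕ → Bool) (n : ℕ) :
    |value ω * den ω n - num ω n| ≤ 1 / den ω n := by
  have e := value_mul_eq ω n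
  have hd := num_mul_den_sub ω n
  have hq := den_pos ω n
  have hq' := den_le_succ ω n
  have hT := value_nonneg (drop ω (n + 1))
  set T := value (drop ω (n + 1))
  set u := den ω (n + 1) + den ω n * T with hu
  have hu1 : den ω n ≤ u := by rw [hu]; nlinarith
  have hu0 : 0 < u := by linarith
  have key : (value ω * den ω n - num ω n) * u = (-1) ^ n := by
    have : (value ω * den ω n - num ω n) * u = (value ω * u) * den ω n - num ω n * u := by ring
    rw [this, e, hu, ← hd]
    ring
  have key' : |value ω * den ω n - num ω n| * u = 1 := by
    have := congrArg abs key
    simpa [abs_mul, abs_of_pos hu0] using this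
  rw [eq_div_of_mul_eq hu0.ne' key']
  exact one_div_le_one_div_of_le hq hu1

lemma one_le_abs_of_lt_den (ω : ℕ → Bool) (n : ℕ) {q : ℕ} (hq : 0 < q) (p : ℤ)
    (h : (q : ℝ) < den ω n) : 1 ≤ |(p : ℝ) * den ω n - q * num ω n| := by
  have hd := num_mul_den_sub ω n
  obtain ⟨⟨⟨a, ha⟩, b, hb⟩, ⟨c, hc⟩, d, hd'⟩ := exists_int_eq_num_den ω n
  rw [ha, hb, hc, hd'] at hd
  rw [hb] at h
  rw [ha, hb]
  have hdet : c * b - a * d = (-1) ^ n := by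
    have h' : ((c * b - a * d : ℤ) : ℝ) = ((-1) ^ n : ℤ) := by push_cast; exact hd
    exact_mod_cast h'
  norm_cast at h ⊢
  by_contra hlt
  have h0 : p * b - q * a = 0 := by
    rw [← abs_eq_zero]
    have := abs_nonneg (p * b - q * a)
    omega
  have hdvd : b ∣ q := by
    have h1 : b ∣ q * (-1) ^ n := ⟨q * c - p * d, by rw [← hdet]; linear_combination d * h0⟩
    rcases neg_one_pow_eq_or ℤ n with h2 | h2 <;> rw [h2] at h1 <;> simpa using h1
  have := Int.le_of_dvd (by exact_mod_cast hq) hdvd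
  omega

lemma value_mem_BAone (ω : ℕ → Bool) : value ω ∈ BAone := by
  refine ⟨1 / 32, by norm_num, fun q hq => ?_⟩
  have hq0 : (1 : ℝ) ≤ q := by exact_mod_cast hq
  have hex : ∃ n, 2 * (q : ℝ) < den ω n := by
    obtain ⟨n, hn⟩ := pow_unbounded_of_one_lt (2 * (q : ℝ)) (show (1 : ℝ) < 2 by norm_num)
    exact ⟨2 * n, hn.trans_le (two_pow_le_den ω n)⟩
  classical
  have hN := Nat.find_spec hex
  have hmin := fun m => Nat.find_min (H := hex) (m := m)
  set N := Nat.find hex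
  have hle : den ω N ≤ 8 * q := by
    rcases hN' : N with _ | m
    · simp only [den]; linarith
    · have h1 := hmin m (by omega)
      have h2 := den_succ_le ω m
      linarith
  have hD := den_pos ω N
  set p : ℤ := round ((q : ℝ) * value ω)
  have h1 := one_le_abs_of_lt_den ω N hq p (by linarith)
  have h2 := abs_value_sub_convergent_le ω N
  have h3 : |(p : ℝ) * den ω N - q * num ω N| ≤
      den ω N * |(q : ℝ) * value ω - p| + q * |value ω * den ω N - num ω N| := by
    have e : (p : ℝ) * den ω N - q * num ω N =
      -(den ω N * ((q : ℝ) * value ω - p)) + q * (value ω * den ω N - num ω N) := by ring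
    rw [e]
    refine (abs_add_le _ _).trans ?_
    rw [abs_neg, abs_mul, abs_mul, abs_of_pos hD, Nat.abs_cast]
  have h4 : q * |value ω * den ω N - num ω N| ≤ 1 / 2 := by
    calc q * |value ω * den ω N - num ω N| ≤ q * (1 / den ω N) := by gcongr
      _ ≤ 1 / 2 := by rw [mul_one_div, div_le_iff₀ hD]; linarith
  have h5 : 1 / 2 ≤ 8 * q * |(q : ℝ) * value ω - p| := by
    have : den ω N * |(q : ℝ) * value ω - p| ≤ 8 * q * |(q : ℝ) * value ω - p| := by gcongr
    linarith
  rw [gt_iff_lt, div_lt_iff₀ (by linarith)]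
  linarith

/-- The uniform probability measure on `Bool`. -/
def coin : Measure Bool := (PMF.uniformOfFintype Bool).toMeasure

instance : IsProbabilityMeasure coin := PMF.toMeasure.isProbabilityMeasure _

lemma coin_singleton (b : Bool) : coin {b} = 2⁻¹ := by
  rw [coin, PMF.toMeasure_apply_singleton _ _ (measurableSet_singleton b)]
  simp

/-- The Bernoulli measure on sequences of Booleans. -/
def bernoulli : Measure (ℕ → Bool) := Measure.infinitePi fun _ => coin

instance : IsProbabilityMeasure bernoulli := by unfold bernoulli; infer_instance

lemma bernoulli_real_cyl (ω : ℕ → Bool) (n : ℕ) : bernoulli.real (cyl ω n) = (1 / 2) ^ n := by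
  rw [measureReal_def, cyl_eq_pi, bernoulli, Measure.infinitePi_pi _ fun i _ => measurableSet_singleton _]
  simp [coin_singleton]

/-- The measure giving mass `2 ^ (-n)` to each cylinder of length `n` of continued fractions with
partial quotients in `{1, 3}`. -/
def cfMeasure : Measure ℝ := bernoulli.map value

instance : IsProbabilityMeasure cfMeasure :=
  Measure.isProbabilityMeasure_map continuous_value.measurable.aemeasurable

lemma le_cfMeasure_real {ω : ℕ → Bool} {n : ℕ} {ρ : ℝ} (h : scale ω n ≤ ρ) :
    (1 / 2) ^ n ≤ cfMeasure.real (closedBall (value ω) ρ) := by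
  rw [cfMeasure, map_measureReal_apply continuous_value.measurable measurableSet_closedBall,
    ← bernoulli_real_cyl ω n]
  refine measureReal_mono fun ω' hω' => ?_
  rw [Set.mem_preimage, mem_closedBall, dist_comm, Real.dist_eq]
  exact (abs_value_sub_le hω').trans h

lemma cfMeasure_real_le {ω : ℕ → Bool} {n : ℕ} {ρ : ℝ} (h : ρ < scale ω n / 24) :
    cfMeasure.real (closedBall (value ω) ρ) ≤ (1 / 2) ^ n := by
  rw [cfMeasure, map_measureReal_apply continuous_value.measurable measurableSet_closedBall,
    ← bernoulli_real_cyl ω n]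
  refine measureReal_mono fun ω' hω' => ?_
  rw [Set.mem_preimage, mem_closedBall, dist_comm, Real.dist_eq] at hω'
  exact mem_cyl_of_abs_lt (hω'.trans_lt h)

lemma cfMeasure_real_pos (ω : ℕ → Bool) {ρ : ℝ} (hρ : 0 < ρ) :
    0 < cfMeasure.real (closedBall (value ω) ρ) := by
  obtain ⟨n, hn⟩ := exists_scale_lt ω hρ
  exact lt_of_lt_of_le (by positivity) (le_cfMeasure_real hn.le)

lemma cfMeasure_real_doubling (ω : ℕ → Bool) {ρ : ℝ} (hρ : 0 < ρ) :
    cfMeasure.real (closedBall (value ω) ρ) ≤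
      128 * cfMeasure.real (closedBall (value ω) (ρ / 2)) := by
  classical
  have hex := exists_scale_lt ω (half_pos hρ)
  have hN := Nat.find_spec hex
  have hmin := fun m => Nat.find_min (H := hex) (m := m)
  set N := Nat.find hex
  have h1 := le_cfMeasure_real hN.le
  rcases lt_or_ge N 7 with h7 | h7
  · have h2 : (1 / 2 : ℝ) ^ 7 ≤ (1 / 2) ^ N :=
      pow_le_pow_of_le_one (by norm_num) (by norm_num) h7.le
    have h3 : cfMeasure.real (closedBall (value ω) ρ) ≤ 1 := measureReal_le_one
    norm_num at h2
    linarith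
  · obtain ⟨k, hk⟩ := Nat.exists_eq_add_of_le' h7
    have h2 := hmin (k + 6) (by omega)
    have a1 := scale_add_two_le ω k
    have a2 := scale_add_two_le ω (k + 2)
    have a3 := scale_add_two_le ω (k + 4)
    have h3 := cfMeasure_real_le (ω := ω) (n := k) (ρ := ρ) (by linarith)
    rw [hk, pow_add] at h1
    linarith

lemma cfMeasure_real_decay (ω : ℕ → Bool) {ρ ε : ℝ} (hρ : 0 < ρ) (hρ1 : ρ ≤ 1) (hε : 0 < ε)
    (hερ : ε ≤ ρ) :
    cfMeasure.real (closedBall (value ω) (2 * ε)) ≤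
      128 * (1000 * (ε / ρ)) ^ (1 / 4 : ℝ) * cfMeasure.real (closedBall (value ω) ρ) := by
  have hx : 0 < 1000 * (ε / ρ) := by positivity
  rcases lt_or_ge 1 (1000 * (ε / ρ)) with h1 | h1
  · have h2 := Real.one_le_rpow h1.le (show (0 : ℝ) ≤ 1 / 4 by norm_num)
    have h3 := cfMeasure_real_doubling ω (show 0 < 2 * ρ by linarith)
    rw [mul_div_cancel_left₀ _ (two_ne_zero' ℝ)] at h3
    have h4 : cfMeasure.real (closedBall (value ω) (2 * ε)) ≤
        cfMeasure.real (closedBall (value ω) (2 * ρ)) :=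
      measureReal_mono (closedBall_subset_closedBall (by linarith))
    have h5 := cfMeasure_real_pos ω hρ
    nlinarith
  · classical
    obtain ⟨j, hj1, hj2⟩ := exists_nat_pow_near_of_lt_one hx h1
      (show (0 : ℝ) < 1 / 16 by norm_num) (by norm_num)
    have hex := exists_scale_lt ω hρ
    have hN := Nat.find_spec hex
    have hmin := fun m => Nat.find_min (H := hex) (m := m)
    set N := Nat.find hex
    have hb : ρ / 16 ≤ scale ω N := by
      rcases hN' : N with _ | m
      · rw [scale_zero]; linarith
      · have h2 := hmin m (by omega)
        have h3 := scale_le_succ ω m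
        linarith
    have hlow := le_cfMeasure_real hN.le
    have hup : cfMeasure.real (closedBall (value ω) (2 * ε)) ≤ (1 / 2) ^ (N + j) := by
      apply cfMeasure_real_le
      have h2 := scale_mul_pow_le ω N j
      have h3 : ρ / 16 * (1000 * (ε / ρ)) ≤ scale ω N * (1 / 16) ^ j :=
        mul_le_mul hb hj2 hx.le (scale_pos ω N).le
      have h4 : ρ / 16 * (1000 * (ε / ρ)) = 1000 / 16 * ε := by field_simp
      linarith
    have hpow : (1 / 2 : ℝ) ^ (j + 1) ≤ (1000 * (ε / ρ)) ^ (1 / 4 : ℝ) := by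
      have h2 := Real.rpow_le_rpow (by positivity) hj1.le (show (0 : ℝ) ≤ 1 / 4 by norm_num)
      have h3 : ((1 / 16 : ℝ) ^ (j + 1)) = ((1 / 2 : ℝ) ^ (j + 1)) ^ (4 : ℕ) := by
        rw [← pow_mul, mul_comm, pow_mul]; norm_num
      rw [h3, ← Real.rpow_natCast _ 4, ← Real.rpow_mul (by positivity)] at h2
      norm_num at h2 ⊢
      exact h2
    have h5 := cfMeasure_real_pos ω hρ
    calc cfMeasure.real (closedBall (value ω) (2 * ε)) ≤ (1 / 2) ^ (N + j) := hup
      _ = 2 * (1 / 2) ^ (j + 1) * (1 / 2) ^ N := by rw [pow_add, pow_succ]; ring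
      _ ≤ 128 * (1000 * (ε / ρ)) ^ (1 / 4 : ℝ) * cfMeasure.real (closedBall (value ω) ρ) := by
        gcongr
        norm_num

lemma isCompact_range_value : IsCompact (Set.range value) := isCompact_range continuous_value

lemma cfMeasure_range : cfMeasure (Set.range value) = 1 := by
  rw [cfMeasure, Measure.map_apply continuous_value.measurable
    isCompact_range_value.measurableSet]
  simp

lemma cfMeasure_eq_zero_of_disjoint {s : Set ℝ} (h : Disjoint s (Set.range value)) :
    cfMeasure s = 0 := by
  refine measure_mono_null h.subset_compl_right ?_
  rw [prob_compl_eq_zero_iff isCompact_range_value.measurableSet]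
  exact cfMeasure_range

lemma msupport_cfMeasure : msupport cfMeasure = Set.range value := by
  ext x
  constructor
  · intro hx
    by_contra hmem
    obtain ⟨r, hr, hsub⟩ := Metric.isOpen_iff.1 isCompact_range_value.isClosed.isOpen_compl x hmem
    exact (hx r hr).ne' (cfMeasure_eq_zero_of_disjoint (Set.disjoint_left.2 hsub))
  · rintro ⟨ω, rfl⟩ r hr
    have h := cfMeasure_real_pos ω (half_pos hr)
    refine lt_of_lt_of_le ?_ (measure_mono (closedBall_subset_ball (half_lt_self hr)))
    exact (ENNReal.toReal_pos_iff.1 h).1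

lemma ofReal_mul_measure_lt {τ : Measure ℝ} [IsFiniteMeasure τ] {s t : Set ℝ} {c : ℝ} (hc : 0 ≤ c)
    (h : c * τ.real s < τ.real t) : ENNReal.ofReal c * τ s < τ t := by
  rw [← ofReal_measureReal (μ := τ) (s := s), ← ofReal_measureReal (μ := τ) (s := t),
    ← ENNReal.ofReal_mul hc]
  exact (ENNReal.ofReal_lt_ofReal_iff_of_nonneg (by positivity)).2 h

lemma lt_ofReal_mul_measure {τ : Measure ℝ} [IsFiniteMeasure τ] {s t : Set ℝ} {c : ℝ} (hc : 0 ≤ c)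
    (h : τ.real s < c * τ.real t) : τ s < ENNReal.ofReal c * τ t := by
  rw [← ofReal_measureReal (μ := τ) (s := s), ← ofReal_measureReal (μ := τ) (s := t),
    ← ENNReal.ofReal_mul hc]
  exact (ENNReal.ofReal_lt_ofReal_iff_of_nonneg (by positivity)).2 h

lemma absolutelyFriendly1_cfMeasure : AbsolutelyFriendly1 cfMeasure := by
  refine ⟨1, 2 * 128 ^ 2 * 1000 ^ (1 / 4 : ℝ), 1 / 256, 1 / 4, one_pos, by positivity,
    by norm_num, by norm_num, fun ρ hρ hρ1 x hx => ?_⟩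
  rw [msupport_cfMeasure] at hx
  obtain ⟨ω, rfl⟩ := hx
  have hpos := cfMeasure_real_pos ω hρ
  refine ⟨fun ε hε hερ p => ?_, ofReal_mul_measure_lt (by norm_num) ?_⟩
  · have hC : 0 < (1000 : ℝ) ^ (1 / 4 : ℝ) * (ε / ρ) ^ (1 / 4 : ℝ) := by positivity
    apply lt_ofReal_mul_measure (by positivity)
    by_cases hdis : Disjoint (closedBall (value ω) ρ ∩ ball p ε) (Set.range value)
    · rw [measureReal_def, cfMeasure_eq_zero_of_disjoint hdis, ENNReal.toReal_zero]
      positivity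
    · obtain ⟨_, ⟨hy1, hy2⟩, ω', rfl⟩ := Set.not_disjoint_iff.1 hdis
      rw [mem_closedBall] at hy1
      rw [mem_ball] at hy2
      have h1 : cfMeasure.real (closedBall (value ω) ρ ∩ ball p ε) ≤
          cfMeasure.real (closedBall (value ω') (2 * ε)) :=
        measureReal_mono (Set.inter_subset_right.trans
          (ball_subset_closedBall.trans
            (closedBall_subset_closedBall' (by rw [dist_comm]; linarith))))
      have h2 := cfMeasure_real_decay ω' hρ hρ1 hε hερ
      have h3 : cfMeasure.real (closedBall (value ω') ρ) ≤
          cfMeasure.real (closedBall (value ω) (2 * ρ)) :=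
        measureReal_mono (closedBall_subset_closedBall' (by linarith))
      have h4 := cfMeasure_real_doubling ω (show 0 < 2 * ρ by linarith)
      rw [mul_div_cancel_left₀ _ (two_ne_zero' ℝ)] at h4
      rw [Real.mul_rpow (by norm_num) (by positivity)] at h2
      have h5 := mul_le_mul_of_nonneg_left (h3.trans h4) hC.le
      have h6 := mul_pos hC hpos
      linarith
  · have h := cfMeasure_real_doubling ω hρ
    linarith

end ContinuedFraction13

/-- **Section 6 of Fishman.** There is an absolutely friendly probability measure on ℝ,
supported on the compact set of numbers with continued fraction partial quotients in {1,3},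
which gives full measure to the badly approximable numbers in its support. Hence an
absolutely friendly measure need not vanish on BA ∩ supp τ. -/
theorem exists_absolutelyFriendly_full_measure_on_BA :
    ∃ τ : Measure ℝ,
      AbsolutelyFriendly1 τ ∧
      msupport τ = cfSet13 ∧
      IsCompact cfSet13 ∧
      cfSet13 ⊆ Set.Icc (0 : ℝ) 1 ∧
      τ (BAone ∩ cfSet13) = 1 ∧
      τ Set.univ = 1 := by
  have hfull : BAone ∩ cfSet13 = cfSet13 := by
    rw [← ContinuedFraction13.range_value]
    refine Set.inter_eq_right.2 ?_
    rintro _ ⟨ω, rfl⟩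
    exact ContinuedFraction13.value_mem_BAone ω
  refine ⟨ContinuedFraction13.cfMeasure, ContinuedFraction13.absolutelyFriendly1_cfMeasure,
    ?_, ?_, ?_, ?_, measure_univ⟩
  · rw [ContinuedFraction13.msupport_cfMeasure, ContinuedFraction13.range_value]
  · rw [← ContinuedFraction13.range_value]
    exact ContinuedFraction13.isCompact_range_value
  · rw [← ContinuedFraction13.range_value]
    rintro _ ⟨ω, rfl⟩
    exact ⟨ContinuedFraction13.value_nonneg ω, ContinuedFraction13.value_le_one ω⟩
  · rw [hfull, ← ContinuedFraction13.range_value]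
    exact ContinuedFraction13.cfMeasure_range
end
end
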